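/- The Lopatinski determinant is positively homogeneous of degree 4 under parabolic scaling: for every s > 0, every λ ∈ Σ_ε, and every ξ' ∈ ℝ^{N−1} ∖ {0}, one has det L(s²λ, sξ') = s⁴ det L(λ, ξ'). -/

import Mathlib

open Real Complex

noncomputable section

/-- The sector `Σ_ε = {λ ∈ ℂ \ {0} : |arg λ| ≤ π - ε}`. -/
def SigmaSector (ε : ℝ) : Set ℂ := {z : ℂ | z ≠ 0 ∧ |z.arg| ≤ Real.pi - ε}

/-- The characteristic root `√(ρ μ⁻¹ λ + A²)` (principal branch of the square root);
`A₊ = charRoot ρ₊ (μ₊ + ν₊) λ A`, `B₊ = charRoot ρ₊ μ₊ λ A`, `B₋ = charRoot ρ₋ μ₋ λ A`. -/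
def charRoot (ρ μ : ℝ) (lam : ℂ) (A : ℝ) : ℂ :=
  ((ρ / μ : ℝ) * lam + (A : ℂ) ^ 2) ^ ((1 : ℂ) / 2)

/-- `L₁₁⁺ = μ₊A₊(B₊² - A²)/(A₊B₊ - A²)`. -/
def L11p (ρp μp νp : ℝ) (lam : ℂ) (A : ℝ) : ℂ :=
  let Ap := charRoot ρp (μp + νp) lam A
  let Bp := charRoot ρp μp lam A
  (μp : ℂ) * Ap * (Bp ^ 2 - (A : ℂ) ^ 2) / (Ap * Bp - (A : ℂ) ^ 2)

/-- `L₁₂⁺ = μ₊A²(2A₊B₊ - A² - B₊²)/(A₊B₊ - A²)`. -/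
def L12p (ρp μp νp : ℝ) (lam : ℂ) (A : ℝ) : ℂ :=
  let Ap := charRoot ρp (μp + νp) lam A
  let Bp := charRoot ρp μp lam A
  (μp : ℂ) * (A : ℂ) ^ 2 * (2 * Ap * Bp - (A : ℂ) ^ 2 - Bp ^ 2) / (Ap * Bp - (A : ℂ) ^ 2)

/-- `L₂₁⁺ = (2μ₊A₊(B₊ - A₊) - (ν₊ - μ₊)(A₊² - A²))/(A₊B₊ - A²)`. -/
def L21p (ρp μp νp : ℝ) (lam : ℂ) (A : ℝ) : ℂ :=
  let Ap := charRoot ρp (μp + νp) lam A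
  let Bp := charRoot ρp μp lam A
  (2 * (μp : ℂ) * Ap * (Bp - Ap) - ((νp : ℂ) - (μp : ℂ)) * (Ap ^ 2 - (A : ℂ) ^ 2)) /
    (Ap * Bp - (A : ℂ) ^ 2)

/-- `L₂₂⁺ = (μ₊ + ν₊)B₊(A₊² - A²)/(A₊B₊ - A²)`. -/
def L22p (ρp μp νp : ℝ) (lam : ℂ) (A : ℝ) : ℂ :=
  let Ap := charRoot ρp (μp + νp) lam A
  let Bp := charRoot ρp μp lam A
  ((μp + νp : ℝ) : ℂ) * Bp * (Ap ^ 2 - (A : ℂ) ^ 2) / (Ap * Bp - (A : ℂ) ^ 2)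

/-- `L₁₁⁻ = μ₋(A + B₋)`. -/
def L11m (ρm μm : ℝ) (lam : ℂ) (A : ℝ) : ℂ :=
  (μm : ℂ) * ((A : ℂ) + charRoot ρm μm lam A)

/-- `L₁₂⁻ = μ₋A(B₋ - A)`. -/
def L12m (ρm μm : ℝ) (lam : ℂ) (A : ℝ) : ℂ :=
  (μm : ℂ) * (A : ℂ) * (charRoot ρm μm lam A - (A : ℂ))

/-- `L₂₁⁻ = μ₋(B₋ - A)`. -/
def L21m (ρm μm : ℝ) (lam : ℂ) (A : ℝ) : ℂ :=
  (μm : ℂ) * (charRoot ρm μm lam A - (A : ℂ))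

/-- `L₂₂⁻ = μ₋(A + B₋)B₋`. -/
def L22m (ρm μm : ℝ) (lam : ℂ) (A : ℝ) : ℂ :=
  (μm : ℂ) * ((A : ℂ) + charRoot ρm μm lam A) * charRoot ρm μm lam A

/-- The Lopatinski determinant
`det L = L₂₂⁻(L₁₁⁺L₂₂⁺ - L₁₂⁺L₂₁⁺) + L₂₂⁺(L₁₁⁻L₂₂⁻ - L₁₂⁻L₂₁⁻)`. -/
def detL (ρp ρm μp μm νp : ℝ) (lam : ℂ) (A : ℝ) : ℂ :=
  L22m ρm μm lam A *
      (L11p ρp μp νp lam A * L22p ρp μp νp lam A - L12p ρp μp νp lam A * L21p ρp μp νp lam A) +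
    L22p ρp μp νp lam A *
      (L11m ρm μm lam A * L22m ρm μm lam A - L12m ρm μm lam A * L21m ρm μm lam A)

/-- Parabolic scaling of the characteristic roots. -/
theorem charRoot_scale (ρ μ : ℝ) {s : ℝ} (hs : 0 < s) (lam : ℂ) (A : ℝ) :
    charRoot ρ μ ((s : ℂ) ^ 2 * lam) (s * A) = s * charRoot ρ μ lam A := by
  have hs' : (s : ℂ) ≠ 0 := by exact_mod_cast hs.ne'
  unfold charRoot
  have harg : ((ρ / μ : ℝ) : ℂ) * ((s : ℂ) ^ 2 * lam) + ((s * A : ℝ) : ℂ) ^ 2 =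
      ((s ^ 2 : ℝ) : ℂ) * (((ρ / μ : ℝ) : ℂ) * lam + (A : ℂ) ^ 2) := by
    push_cast; ring
  rw [harg]
  generalize ((ρ / μ : ℝ) : ℂ) * lam + (A : ℂ) ^ 2 = z
  rcases eq_or_ne z 0 with rfl | hz
  · simp
  have h2 : ((s ^ 2 : ℝ) : ℂ) ≠ 0 := by exact_mod_cast (pow_pos hs 2).ne'
  rw [Complex.cpow_def_of_ne_zero (mul_ne_zero h2 hz), Complex.cpow_def_of_ne_zero hz,
    Complex.log_ofReal_mul (pow_pos hs 2) hz, Real.log_pow, add_mul, Complex.exp_add]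
  congr 1
  rw [show ((((2 : ℕ) : ℝ) * Real.log s : ℝ) : ℂ) * (1 / 2) = ((Real.log s : ℝ) : ℂ) by
    push_cast; ring, ← Complex.ofReal_exp, Real.exp_log hs]

/-- A quotient of a form of degree `m + 2` by one of degree `2` has degree `m`. -/
theorem scale_div {s : ℂ} (hs : s ≠ 0) (m : ℕ) (n d : ℂ) :
    s ^ (m + 2) * n / (s ^ 2 * d) = s ^ m * (n / d) := by
  rw [pow_add, mul_comm (s ^ m), mul_assoc, mul_div_mul_left _ _ (pow_ne_zero 2 hs), mul_div_assoc]

theorem L11p_scale (ρp μp νp : ℝ) {s : ℝ} (hs : 0 < s) (lam : ℂ) (A : ℝ) :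
    L11p ρp μp νp ((s : ℂ) ^ 2 * lam) (s * A) = (s : ℂ) ^ 1 * L11p ρp μp νp lam A := by
  simp only [L11p, charRoot_scale _ _ hs, Complex.ofReal_mul]
  rw [← scale_div (Complex.ofReal_ne_zero.mpr hs.ne')]
  congr 1 <;> ring

theorem L12p_scale (ρp μp νp : ℝ) {s : ℝ} (hs : 0 < s) (lam : ℂ) (A : ℝ) :
    L12p ρp μp νp ((s : ℂ) ^ 2 * lam) (s * A) = (s : ℂ) ^ 2 * L12p ρp μp νp lam A := by
  simp only [L12p, charRoot_scale _ _ hs, Complex.ofReal_mul]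
  rw [← scale_div (Complex.ofReal_ne_zero.mpr hs.ne')]
  congr 1 <;> ring

theorem L21p_scale (ρp μp νp : ℝ) {s : ℝ} (hs : 0 < s) (lam : ℂ) (A : ℝ) :
    L21p ρp μp νp ((s : ℂ) ^ 2 * lam) (s * A) = (s : ℂ) ^ 0 * L21p ρp μp νp lam A := by
  simp only [L21p, charRoot_scale _ _ hs, Complex.ofReal_mul]
  rw [← scale_div (Complex.ofReal_ne_zero.mpr hs.ne')]
  congr 1 <;> ring

theorem L22p_scale (ρp μp νp : ℝ) {s : ℝ} (hs : 0 < s) (lam : ℂ) (A : ℝ) :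
    L22p ρp μp νp ((s : ℂ) ^ 2 * lam) (s * A) = (s : ℂ) ^ 1 * L22p ρp μp νp lam A := by
  simp only [L22p, charRoot_scale _ _ hs, Complex.ofReal_mul]
  rw [← scale_div (Complex.ofReal_ne_zero.mpr hs.ne')]
  congr 1 <;> ring

theorem L11m_scale (ρm μm : ℝ) {s : ℝ} (hs : 0 < s) (lam : ℂ) (A : ℝ) :
    L11m ρm μm ((s : ℂ) ^ 2 * lam) (s * A) = (s : ℂ) ^ 1 * L11m ρm μm lam A := by
  simp only [L11m, charRoot_scale _ _ hs, Complex.ofReal_mul]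
  ring

theorem L12m_scale (ρm μm : ℝ) {s : ℝ} (hs : 0 < s) (lam : ℂ) (A : ℝ) :
    L12m ρm μm ((s : ℂ) ^ 2 * lam) (s * A) = (s : ℂ) ^ 2 * L12m ρm μm lam A := by
  simp only [L12m, charRoot_scale _ _ hs, Complex.ofReal_mul]
  ring

theorem L21m_scale (ρm μm : ℝ) {s : ℝ} (hs : 0 < s) (lam : ℂ) (A : ℝ) :
    L21m ρm μm ((s : ℂ) ^ 2 * lam) (s * A) = (s : ℂ) ^ 1 * L21m ρm μm lam A := by
  simp only [L21m, charRoot_scale _ _ hs, Complex.ofReal_mul]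
  ring

theorem L22m_scale (ρm μm : ℝ) {s : ℝ} (hs : 0 < s) (lam : ℂ) (A : ℝ) :
    L22m ρm μm ((s : ℂ) ^ 2 * lam) (s * A) = (s : ℂ) ^ 2 * L22m ρm μm lam A := by
  simp only [L22m, charRoot_scale _ _ hs, Complex.ofReal_mul]
  ring

/-- the Lopatinski determinant is positively homogeneous of degree 4 under
parabolic scaling: `det L(s²λ, sξ') = s⁴ det L(λ, ξ')` for `s > 0`, `λ ∈ Σ_ε`,
`ξ' ∈ ℝ^{N-1} \ {0}`. -/
theorem statement6 (N : ℕ) (hN : 2 ≤ N) (ε : ℝ) (hε0 : 0 < ε) (hεπ : ε < Real.pi / 2)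
    (ρp ρm μp μm νp : ℝ) (hρp : 0 < ρp) (hρm : 0 < ρm) (hμp : 0 < μp) (hμm : 0 < μm)
    (hνp : 0 < νp) :
    ∀ s : ℝ, 0 < s → ∀ lam ∈ SigmaSector ε, ∀ ξ : EuclideanSpace ℝ (Fin (N - 1)), ξ ≠ 0 →
      detL ρp ρm μp μm νp ((s : ℂ) ^ 2 * lam) ‖s • ξ‖ =
        (s : ℂ) ^ 4 * detL ρp ρm μp μm νp lam ‖ξ‖ := by
  intro s hs lam _ ξ _
  rw [norm_smul, Real.norm_of_nonneg hs.le]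
  simp only [detL, L11p_scale _ _ _ hs, L12p_scale _ _ _ hs, L21p_scale _ _ _ hs,
    L22p_scale _ _ _ hs, L11m_scale _ _ hs, L12m_scale _ _ hs, L21m_scale _ _ hs,
    L22m_scale _ _ hs]
  ring
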